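/- Tight GFG Streett automata are co-Büchi-type: if A = (Σ, Q, Q₀, δ, α) is a tight GFG Streett automaton such that L(A) is recognized by some GFG co-Büchi automaton, then there exists a co-Büchi condition α' ⊆ Q such that the co-Büchi automaton A' = (Σ, Q, Q₀, δ, α') is GFG and equivalent to A. -/

import Mathlib

namespace GFG

/-- The structure of a nondeterministic automaton on infinite words:
alphabet `A`, states `Q`, initial states and transition function.
The acceptance condition is kept separate, as a predicate on the set
of states visited infinitely often. -/
structure Auto (A Q : Type) where
  init : Set Q
  next : Q → A → Set Q

variable {A Q Mem : Type}

/-- `r` is a run of the automaton `M` on the infinite word `w`. -/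
def Auto.IsRun (M : Auto A Q) (w : ℕ → A) (r : ℕ → Q) : Prop :=
  r 0 ∈ M.init ∧ ∀ i, r (i + 1) ∈ M.next (r i) (w i)

/-- The set of states occurring infinitely often in `r`. -/
def InfOcc (r : ℕ → Q) : Set Q := {q | ∀ n, ∃ m, n ≤ m ∧ r m = q}

/-- The language of `M` with acceptance condition `acc` (a predicate on `inf(r)`). -/
def Auto.Lang (M : Auto A Q) (acc : Set Q → Prop) : Set (ℕ → A) :=
  {w | ∃ r, M.IsRun w r ∧ acc (InfOcc r)}

/-- `M` is deterministic: one initial state and at most one successor per state/letter. -/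
def Auto.IsDet (M : Auto A Q) : Prop :=
  (∃ q0, M.init = {q0}) ∧ ∀ q a, (M.next q a).Subsingleton

/-- `A^q`: the automaton `M` with set of initial states `{q}`. -/
def Auto.withInit (M : Auto A Q) (q : Q) : Auto A Q := ⟨{q}, M.next⟩

/-- Büchi condition: `inf(r) ∩ α ≠ ∅`. -/
def BuchiAcc (α : Set Q) (S : Set Q) : Prop := (S ∩ α).Nonempty

/-- co-Büchi condition: `inf(r) ∩ α = ∅`. -/
def CoBuchiAcc (α : Set Q) (S : Set Q) : Prop := S ∩ α = ∅

/-- Rabin condition with bad sets `E i` and good sets `F i`. -/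
def RabinAcc {ι : Type} (E F : ι → Set Q) (S : Set Q) : Prop :=
  ∃ i, S ∩ E i = ∅ ∧ (S ∩ F i).Nonempty

/-- Streett condition with pairs `(E i, F i)`. -/
def StreettAcc {ι : Type} (E F : ι → Set Q) (S : Set Q) : Prop :=
  ∀ i, S ∩ E i = ∅ ∨ (S ∩ F i).Nonempty

/-- Parity condition: the minimal priority seen infinitely often is even. -/
def ParityAcc (c : Q → ℕ) (S : Set Q) : Prop := Even (sInf (c '' S))

/-- The prefix of length `n` of the infinite word `w`, as a list. -/
def prefixWord (w : ℕ → A) (n : ℕ) : List A := (List.range n).map w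

/-- The run induced by a strategy `g : A* → Q` on the word `w`:
`g(ε), g(a₁), g(a₁a₂), …`. -/
def StrategyRun (g : List A → Q) (w : ℕ → A) : ℕ → Q := fun n => g (prefixWord w n)

/-- `g` witnesses GFGness of `M` (with acceptance `acc`): for every word `w` the
induced sequence is a run of `M` on `w`, accepting whenever `w ∈ L(M)`. -/
def IsGFGStrategy (M : Auto A Q) (acc : Set Q → Prop) (g : List A → Q) : Prop :=
  ∀ w : ℕ → A, M.IsRun w (StrategyRun g w) ∧
    (w ∈ M.Lang acc → acc (InfOcc (StrategyRun g w)))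

/-- `M` is good for games. -/
def IsGFG (M : Auto A Q) (acc : Set Q → Prop) : Prop :=
  ∃ g : List A → Q, IsGFGStrategy M acc g

/-- `M` is unambiguous: every word of the language has exactly one accepting run. -/
def Unambiguous (M : Auto A Q) (acc : Set Q → Prop) : Prop :=
  ∀ w ∈ M.Lang acc, ∃! r : ℕ → Q, M.IsRun w r ∧ acc (InfOcc r)

/-- `M` is determinizable by pruning. -/
def DetByP (M : Auto A Q) (acc : Set Q → Prop) : Prop :=
  ∃ q0 ∈ M.init, ∃ next' : Q → A → Set Q,
    (∀ q a, next' q a ⊆ M.next q a ∧ (next' q a).Subsingleton) ∧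
    (⟨{q0}, next'⟩ : Auto A Q).Lang acc = M.Lang acc

/-- A finite-state strategy (transducer): memories `Mem`, initial memory `m0`,
memory update function `upd` and output function `out`. -/
structure Transducer (A Q Mem : Type) where
  m0 : Mem
  upd : Mem → A → Mem
  out : Mem → Q

namespace Transducer

variable (T : Transducer A Q Mem)

/-- The memory reached from `m` after reading the finite word `u`. -/
def run (m : Mem) (u : List A) : Mem := u.foldl T.upd m

/-- The strategy generated by the transducer: `u ↦ τ(ρ(m₀, u))`. -/
def strategy : List A → Q := fun u => T.out (T.run T.m0 u)

/-- The deterministic automaton `A_g`, with initial memory replaced by `m`. -/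
def autoFrom (m : Mem) : Auto A Mem := ⟨{m}, fun m' a => {T.upd m' a}⟩

/-- The deterministic automaton `A_g` itself. -/
def auto : Auto A Mem := T.autoFrom T.m0

/-- The acceptance condition `α_g` of `A_g`, obtained from `acc` by replacing each
set `F ⊆ Q` appearing in it by `{m | τ(m) ∈ F}`. -/
def accG (acc : Set Q → Prop) : Set Mem → Prop := fun S => acc (T.out '' S)

/-- `m` is reachable in `A_g` from the initial memory. -/
def Reachable (m : Mem) : Prop := ∃ u : List A, T.run T.m0 u = m

/-- The set of memories visited along the path of `A_g` that starts at `m` and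
reads the finite word `u` (both endpoints included). -/
def pathStates (m : Mem) (u : List A) : Set Mem :=
  {m' | ∃ v : List A, v <+: u ∧ T.run m v = m'}

/-- `P_{src → dst}`: the (words inducing the) finite paths of `A_g` from `src` to `dst`. -/
def PathSet (src dst : Mem) : Set (List A) :=
  {u : List A | u ≠ [] ∧ T.run src u = dst}

/-- Every combination of paths from `P_{src → dst}` satisfies `α_g`. -/
def AllCombosAcc (acc : Set Q → Prop) (src dst : Mem) : Prop :=
  ∀ S : Set (List A), S.Nonempty → S ⊆ T.PathSet src dst →
    T.accG acc (⋃ u ∈ S, T.pathStates src u)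

/-- `P_{src → dst}` is empty, or every combination of its paths satisfies `α_g`. -/
def GoodPathSet (acc : Set Q → Prop) (src dst : Mem) : Prop :=
  T.PathSet src dst = ∅ ∨ T.AllCombosAcc acc src dst

/-- `m` is replaceable by `m'`: the set `P_{m' → m}` of paths of `A_g` from `m'`
to `m` is empty, or every combination of its paths satisfies `α_g`. -/
def Replaceable (acc : Set Q → Prop) (m m' : Mem) : Prop :=
  T.GoodPathSet acc m' m

/-- The transition `(q, a, q')` is used by the strategy. -/
def Uses (q : Q) (a : A) (q' : Q) : Prop :=
  ∃ u : List A, T.strategy u = q ∧ T.strategy (u ++ [a]) = q'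

/-- The nonempty word `u` induces a cycle of `A_g` through the memory `m`. -/
def CycleThrough (m : Mem) (u : List A) : Prop := u ≠ [] ∧ T.run m u = m

/-- The cycle of `A_g` through `m` induced by `u` is accepting. -/
def AccCycle (acc : Set Q → Prop) (m : Mem) (u : List A) : Prop :=
  T.CycleThrough m u ∧ T.accG acc (T.pathStates m u)

/-- The cycle of `A_g` through `m` induced by `u` is rejecting. -/
def RejCycle (acc : Set Q → Prop) (m : Mem) (u : List A) : Prop :=
  T.CycleThrough m u ∧ ¬ T.accG acc (T.pathStates m u)

/-- The cycle of `A_g` through `m` induced by `u` is `q`-exclusive accepting: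
it is accepting, but its set of memories minus the memories of `q` is not. -/
def ExclAccCycle (acc : Set Q → Prop) (q : Q) (m : Mem) (u : List A) : Prop :=
  T.CycleThrough m u ∧ T.accG acc (T.pathStates m u) ∧
    ¬ T.accG acc (T.pathStates m u \ {m' : Mem | T.out m' = q})

end Transducer

/-- `M` is weakly tight with respect to `T`: every transition of `M` is used. -/
def WeaklyTightWrt (M : Auto A Q) (T : Transducer A Q Mem) : Prop :=
  ∀ q a q', q' ∈ M.next q a → T.Uses q a q'

/-- `M` is tight with respect to `T`: every transition of `M` is used, and no memory
is replaceable by a different memory of the same state. -/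
def TightWrt (M : Auto A Q) (acc : Set Q → Prop) (T : Transducer A Q Mem) : Prop :=
  WeaklyTightWrt M T ∧
  ∀ m m' : Mem, m ≠ m' → T.out m = T.out m' → ¬ T.Replaceable acc m m'

/-- `M` is tight: tight with respect to some finite-state strategy witnessing its GFGness. -/
def Tight (M : Auto A Q) (acc : Set Q → Prop) : Prop :=
  ∃ (Mem : Type) (_ : Fintype Mem) (T : Transducer A Q Mem),
    IsGFGStrategy M acc T.strategy ∧ TightWrt M acc T

/-- `M` is weakly tight: weakly tight with respect to some finite-state strategy
witnessing its GFGness. -/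
def WeaklyTight (M : Auto A Q) (acc : Set Q → Prop) : Prop :=
  ∃ (Mem : Type) (_ : Fintype Mem) (T : Transducer A Q Mem),
    IsGFGStrategy M acc T.strategy ∧ WeaklyTightWrt M T

/-- A Rabin automaton `M` (with pairs `(E i, F i)`) is strongly tight with respect to `T`:
tight, and every state appearing in some good set has a `q`-exclusive accepting cycle
in `A_g`. -/
def StronglyTightWrt {ι : Type} (M : Auto A Q) (E F : ι → Set Q)
    (T : Transducer A Q Mem) : Prop :=
  TightWrt M (RabinAcc E F) T ∧
  ∀ q : Q, (∃ i, q ∈ F i) →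
    ∃ (m : Mem) (u : List A), T.ExclAccCycle (RabinAcc E F) q m u

/-- A Rabin automaton is strongly tight: strongly tight with respect to some finite-state
strategy witnessing its GFGness. -/
def StronglyTight {ι : Type} (M : Auto A Q) (E F : ι → Set Q) : Prop :=
  ∃ (Mem : Type) (_ : Fintype Mem) (T : Transducer A Q Mem),
    IsGFGStrategy M (RabinAcc E F) T.strategy ∧ StronglyTightWrt M E F T

/-- One-step reachability in the transition graph of `M`. -/
def Auto.Step (M : Auto A Q) (q q' : Q) : Prop := ∃ a, q' ∈ M.next q a

/-- Reachability in the transition graph of `M`. -/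
def Auto.Reach (M : Auto A Q) : Q → Q → Prop := Relation.ReflTransGen M.Step

/-- The Büchi automaton `(M, α)` is weak: each strongly connected component is either
contained in `α` or disjoint from `α`. -/
def Auto.IsWeak (M : Auto A Q) (α : Set Q) : Prop :=
  ∀ q q', M.Reach q q' → M.Reach q' q → (q ∈ α ↔ q' ∈ α)

theorem infOcc_shift (r : ℕ → Q) (k : ℕ) : InfOcc (fun n => r (k + n)) = InfOcc r := by
  ext q
  constructor
  · intro h n
    obtain ⟨m, hm, e⟩ := h n
    exact ⟨k + m, by omega, e⟩
  · intro h n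
    obtain ⟨m, hm, e⟩ := h (k + n)
    refine ⟨m - k, by omega, ?_⟩
    show r (k + (m - k)) = q
    rw [show k + (m - k) = m by omega]
    exact e

theorem exists_infOcc_of_freq [Finite Q] (r : ℕ → Q) (B : Set Q)
    (h : ∀ n, ∃ m, n ≤ m ∧ r m ∈ B) : (InfOcc r ∩ B).Nonempty := by
  by_contra hne
  have h1 : ∀ q : Q, ∃ n, q ∈ B → ∀ m, n ≤ m → r m ≠ q := by
    intro q
    by_contra hq
    push Not at hq
    apply hne
    exact ⟨q, fun n => (hq n).2, (hq 0).1⟩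
  choose n hn using h1
  have := Fintype.ofFinite Q
  obtain ⟨m, hm, hB⟩ := h (Finset.univ.sup n)
  exact hn (r m) hB m (le_trans (Finset.le_sup (Finset.mem_univ _)) hm) rfl

theorem eventually_infOcc [Finite Q] (r : ℕ → Q) : ∃ N, ∀ m, N ≤ m → r m ∈ InfOcc r := by
  by_contra h
  push Not at h
  obtain ⟨q, hq, hq'⟩ := exists_infOcc_of_freq r {q | q ∉ InfOcc r} h
  exact hq' hq

/-- prepend a letter -/
def consW (a : A) (w : ℕ → A) : ℕ → A
  | 0 => a
  | n + 1 => w n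

/-- prepend a finite word -/
def app : List A → (ℕ → A) → (ℕ → A)
  | [], w => w
  | a :: u, w => consW a (app u w)

theorem app_append (u v : List A) (w : ℕ → A) : app (u ++ v) w = app u (app v w) := by
  induction u with
  | nil => rfl
  | cons a u ih => simp [app, ih]

theorem prefix_consW (a : A) (w : ℕ → A) (n : ℕ) :
    prefixWord (consW a w) (n + 1) = a :: prefixWord w n := by
  simp [prefixWord, List.range_succ_eq_map, consW, Function.comp_def]

theorem prefix_app (u : List A) (w : ℕ → A) (k : ℕ) :
    prefixWord (app u w) (u.length + k) = u ++ prefixWord w k := by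
  induction u with
  | nil => simp [app]
  | cons a u ih =>
    rw [List.length_cons, show u.length + 1 + k = (u.length + k) + 1 by omega, app, prefix_consW, ih]
    rfl

theorem app_len (u : List A) (w : ℕ → A) (k : ℕ) : app u w (u.length + k) = w k := by
  induction u with
  | nil => simp [app]
  | cons a u ih =>
    rw [List.length_cons, show u.length + 1 + k = (u.length + k) + 1 by omega, app, consW, ih]

theorem prefix_succ (w : ℕ → A) (n : ℕ) : prefixWord w (n + 1) = prefixWord w n ++ [w n] := by
  simp [prefixWord, List.range_succ]

theorem consW_shift (w : ℕ → A) (n : ℕ) :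
    consW (w n) (fun t => w (n + 1 + t)) = fun t => w (n + t) := by
  funext t
  cases t with
  | zero => rfl
  | succ t => show w (n + 1 + t) = w (n + (t + 1)); congr 1; omega

/-- language from a state -/
def LF (M : Auto A Q) (acc : Set Q → Prop) (q : Q) (w : ℕ → A) : Prop :=
  ∃ r : ℕ → Q, r 0 = q ∧ (∀ i, r (i + 1) ∈ M.next (r i) (w i)) ∧ acc (InfOcc r)

theorem LF_cons {M : Auto A Q} {acc : Set Q → Prop} {q q' : Q} {a : A} {w : ℕ → A}
    (h : q' ∈ M.next q a) (hw : LF M acc q' w) : LF M acc q (consW a w) := by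
  obtain ⟨r, h0, hs, ha⟩ := hw
  refine ⟨consW q r, rfl, ?_, ?_⟩
  · intro i
    cases i with
    | zero => show r 0 ∈ _; rw [h0]; exact h
    | succ i => exact hs i
  · have e := infOcc_shift (consW q r) 1
    have e2 : (fun n => consW q r (1 + n)) = r := by
      funext n; rw [Nat.add_comm]; rfl
    rw [e2] at e
    rwa [← e]

theorem strat_step {M : Auto A Q} {acc : Set Q → Prop} {g : List A → Q}
    (hg : IsGFGStrategy M acc g) (y : List A) (a : A) : g (y ++ [a]) ∈ M.next (g y) a := by
  have h := (hg (app (y ++ [a]) (fun _ => a))).1.2 y.length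
  have e1 : prefixWord (app (y ++ [a]) (fun _ => a)) (y.length + 1) = y ++ [a] := by
    have := prefix_app (y ++ [a]) (fun _ => a) 0
    simpa [prefixWord] using this
  have e2 : prefixWord (app (y ++ [a]) (fun _ => a)) y.length = y := by
    have := prefix_app y (app [a] (fun _ => a)) 0
    rw [← app_append] at this
    simpa [prefixWord] using this
  have e3 : app (y ++ [a]) (fun _ => a) y.length = a := by
    have := app_len y (app [a] (fun _ => a)) 0
    rw [← app_append] at this
    simpa [app, consW] using this
  unfold StrategyRun at h
  rwa [e1, e2, e3] at h

theorem LF_to_lang {M : Auto A Q} {acc : Set Q → Prop} {g : List A → Q}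
    (hg : IsGFGStrategy M acc g) (y : List A) :
    ∀ w, LF M acc (g y) w → app y w ∈ M.Lang acc := by
  induction y using List.reverseRecOn with
  | nil =>
    intro w hw
    obtain ⟨r, h0, hs, ha⟩ := hw
    refine ⟨r, ⟨?_, hs⟩, ha⟩
    rw [h0]
    exact (hg w).1.1
  | append_singleton y a ih =>
    intro w hw
    rw [app_append]
    exact ih _ (LF_cons (strat_step hg y a) hw)

theorem lang_to_LF {M : Auto A Q} {acc : Set Q → Prop} {g : List A → Q}
    (hg : IsGFGStrategy M acc g) (y : List A) (w : ℕ → A) (h : app y w ∈ M.Lang acc) :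
    LF M acc (g y) w := by
  obtain ⟨⟨_, hs⟩, ha⟩ := hg (app y w)
  have ha := ha h
  have e : ∀ n, StrategyRun g (app y w) (y.length + n) = g (y ++ prefixWord w n) := by
    intro n; unfold StrategyRun; rw [prefix_app]
  refine ⟨fun n => StrategyRun g (app y w) (y.length + n), ?_, ?_, ?_⟩
  · show StrategyRun g (app y w) (y.length + 0) = g y
    rw [e]; simp [prefixWord]
  · intro i
    have := hs (y.length + i)
    rwa [app_len] at this
  · rwa [infOcc_shift]

/-- `l` is a labelled path from `q` to `q'`. -/
def Pth (M : Auto A Q) : Q → List (A × Q) → Q → Prop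
  | q, [], q' => q = q'
  | q, x :: l, q' => x.2 ∈ M.next q x.1 ∧ Pth M x.2 l q'

/-- states on a labelled path -/
def sts (l : List (A × Q)) : Set Q := {q | ∃ x ∈ l, x.2 = q}

theorem sts_append (l l' : List (A × Q)) : sts (l ++ l') = sts l ∪ sts l' := by
  ext q; simp only [sts, List.mem_append, Set.mem_ofPred_eq, Set.mem_union]; grind

theorem Pth_append {M : Auto A Q} {q q' q'' : Q} {l l' : List (A × Q)}
    (h : Pth M q l q') (h' : Pth M q' l' q'') : Pth M q (l ++ l') q'' := by
  induction l generalizing q with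
  | nil => cases h; exact h'
  | cons x l ih => exact ⟨h.1, ih h.2⟩

theorem Pth_split {M : Auto A Q} {q q'' : Q} {l l' : List (A × Q)}
    (h : Pth M q (l ++ l') q'') : ∃ q', Pth M q l q' ∧ Pth M q' l' q'' := by
  induction l generalizing q with
  | nil => exact ⟨q, rfl, h⟩
  | cons x l ih =>
    obtain ⟨q', h1, h2⟩ := ih h.2
    exact ⟨q', ⟨h.1, h1⟩, h2⟩

theorem Pth_seg {M : Auto A Q} (f : ℕ → A × Q) (r : ℕ → Q)
    (hs : ∀ t, (f t).2 ∈ M.next (r t) (f t).1) (hr : ∀ t, r (t + 1) = (f t).2) (n : ℕ) :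
    Pth M (r 0) (prefixWord f n) (r n) := by
  induction n with
  | zero => rfl
  | succ n ih =>
    rw [prefix_succ]
    exact Pth_append ih ⟨hs n, (hr n).symm⟩

theorem Pth_run {M : Auto A Q} (f : ℕ → A × Q) (q q' : Q) (n : ℕ)
    (h : Pth M q (prefixWord f n) q') :
    consW q (fun i => (f i).2) n = q' ∧
    ∀ i < n, (f i).2 ∈ M.next (consW q (fun i => (f i).2) i) (f i).1 := by
  induction n generalizing q' with
  | zero => exact ⟨h, by omega⟩
  | succ n ih =>
    rw [prefix_succ] at h
    obtain ⟨s, h1, h2, h3⟩ := Pth_split h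
    obtain ⟨h4, h5⟩ := ih s h1
    refine ⟨h3, fun i hi => ?_⟩
    rcases Nat.lt_succ_iff_lt_or_eq.mp hi with hi | hi
    · exact h5 i hi
    · subst hi; rw [h4]; exact h2

theorem residual {M : Auto A Q} {acc : Set Q → Prop} {T : Transducer A Q Mem}
    (hg : IsGFGStrategy M acc T.strategy) (hu : WeaklyTightWrt M T)
    {p p' : Q} {l : List (A × Q)} (h : Pth M p l p') (w : ℕ → A)
    (hw : LF M acc p (app (l.map Prod.fst) w)) : LF M acc p' w := by
  induction l generalizing p with
  | nil => cases h; exact hw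
  | cons x l ih =>
    obtain ⟨y, hy, hy'⟩ := hu _ _ _ h.1
    apply ih h.2
    rw [← hy']
    apply lang_to_LF hg
    rw [app_append]
    apply LF_to_lang hg
    rw [hy]
    exact hw

theorem mem_sts_seg (f : ℕ → A × Q) (n : ℕ) (q : Q) :
    q ∈ sts (prefixWord f n) ↔ ∃ i < n, (f i).2 = q := by
  simp [sts, prefixWord]

/-- a loop through all the states seen infinitely often -/
theorem exists_loop [Finite Q] {M : Auto A Q} (w : ℕ → A) (r : ℕ → Q)
    (hs : ∀ i, r (i + 1) ∈ M.next (r i) (w i)) (hI : ∀ i, r i ∈ InfOcc r) :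
    ∃ l : List (A × Q), Pth M (r 0) l (r 0) ∧ sts l = InfOcc r := by
  have := Fintype.ofFinite Q
  have h1 : ∀ q : Q, ∃ m, q ∈ InfOcc r → 1 ≤ m ∧ r m = q := by
    intro q
    by_cases hq : q ∈ InfOcc r
    · obtain ⟨m, hm⟩ := hq 1
      exact ⟨m, fun _ => hm⟩
    · exact ⟨0, fun h => absurd h hq⟩
  choose m hm using h1
  obtain ⟨k, hk, hk0⟩ := hI 0 (Finset.univ.sup m)
  refine ⟨prefixWord (fun t => (w t, r (t + 1))) k, ?_, ?_⟩
  · have := Pth_seg (M := M) (fun t => (w t, r (t + 1))) r hs (fun _ => rfl) k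
    rwa [hk0] at this
  · ext q
    rw [mem_sts_seg]
    constructor
    · rintro ⟨i, _, rfl⟩
      exact hI _
    · intro hq
      obtain ⟨h1, h2⟩ := hm q hq
      have h3 : m q ≤ Finset.univ.sup m := Finset.le_sup (Finset.mem_univ q)
      refine ⟨m q - 1, by omega, ?_⟩
      show r (m q - 1 + 1) = q
      rw [show m q - 1 + 1 = m q by omega]
      exact h2

/-- insert loops into a path -/
theorem insert_loops {M : Auto A Q} (I : Set Q) (D : Q → List (A × Q))
    (hD : ∀ p ∈ I, Pth M p (D p) p) {p q : Q} {l : List (A × Q)} (h : Pth M p l q)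
    (hl : sts l ⊆ I) :
    ∃ l', Pth M p l' q ∧ sts l' = sts l ∪ {s | ∃ t ∈ sts l, s ∈ sts (D t)} := by
  induction l generalizing p with
  | nil => exact ⟨[], h, by simp [sts]⟩
  | cons x l ih =>
    have hx : x.2 ∈ sts (x :: l) := ⟨x, by simp, rfl⟩
    have e : sts (x :: l) = {x.2} ∪ sts l := by
      ext s; simp [sts, eq_comm]
    obtain ⟨l', h1, h2⟩ := ih h.2 (fun s hs => hl (by rw [e]; exact Or.inr hs))
    refine ⟨x :: (D x.2 ++ l'), ⟨h.1, Pth_append (hD _ (hl hx)) h1⟩, ?_⟩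
    have e' : sts (x :: (D x.2 ++ l')) = {x.2} ∪ (sts (D x.2) ∪ sts l') := by
      rw [← sts_append]; ext s; simp [sts, eq_comm]
    rw [e', h2, e]
    ext s
    simp only [Set.mem_union, Set.mem_singleton_iff, Set.mem_ofPred_eq]
    grind

/-- the limit of a growing sequence of lists -/
theorem exists_limit {X : Type} (Z : ℕ → List X) (ext : ℕ → List X)
    (hZ : ∀ j, Z (j + 1) = Z j ++ ext j) (hne : ∀ j, ext j ≠ []) :
    ∃ f : ℕ → X, ∀ j, prefixWord f (Z j).length = Z j := by
  have hlen : ∀ j, j ≤ (Z j).length := by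
    intro j
    induction j with
    | zero => omega
    | succ j ih =>
      rw [hZ, List.length_append]
      have := List.length_pos_iff.mpr (hne j)
      omega
  have hpre : ∀ i j, i ≤ j → Z i <+: Z j := by
    intro i j hij
    induction hij with
    | refl => exact List.prefix_rfl
    | step _ ih => exact ih.trans (by rw [Nat.succ_eq_add_one, hZ]; exact List.prefix_append _ _)
  refine ⟨fun i => (Z (i + 1))[i]'(hlen (i + 1)), fun j => ?_⟩
  apply List.ext_getElem
  · simp [prefixWord]
  · intro i h1 h2
    simp only [prefixWord, List.getElem_map, List.getElem_range]
    rcases le_total (i + 1) j with h | h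
    · exact (hpre _ _ h).getElem _
    · exact ((hpre _ _ h).getElem _).symm

/-- infinite iteration of loops with the same set of states -/
theorem iterate_loops {M : Auto A Q} (acc : Set Q → Prop) (p : Q) (S : Set Q) (hS : acc S)
    (hp : S.Nonempty) (Z : ℕ → List (A × Q)) (ext : ℕ → List (A × Q)) (hZ0 : Z 0 = [])
    (hZ : ∀ j, Z (j + 1) = Z j ++ ext j) (hext : ∀ j, sts (ext j) = S)
    (hP : ∀ j, Pth M p (Z j) p) :
    ∃ w : ℕ → A, LF M acc p w ∧ ∀ j, j ≤ (Z j).length ∧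
      prefixWord w (Z j).length = (Z j).map Prod.fst := by
  have hne : ∀ j, ext j ≠ [] := by
    intro j h
    have := hext j
    rw [h] at this
    obtain ⟨s, hs⟩ := hp
    rw [← this] at hs
    simp [sts] at hs
  obtain ⟨f, hf⟩ := exists_limit Z ext hZ hne
  have hlen : ∀ j, j ≤ (Z j).length := by
    intro j
    induction j with
    | zero => omega
    | succ j ih =>
      rw [hZ, List.length_append]
      have := List.length_pos_iff.mpr (hne j)
      omega
  have hsub : ∀ j, sts (Z j) ⊆ S := by
    intro j
    induction j with
    | zero => rw [hZ0]; simp [sts]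
    | succ j ih => rw [hZ, sts_append, hext]; exact Set.union_subset ih le_rfl
  have hin : ∀ i, (f i).2 ∈ S := by
    intro i
    apply hsub (i + 1)
    rw [← hf, mem_sts_seg]
    exact ⟨i, hlen (i + 1), rfl⟩
  refine ⟨fun i => (f i).1, ⟨consW p (fun i => (f i).2), rfl, ?_, ?_⟩, fun j => ⟨hlen j, ?_⟩⟩
  · intro i
    have := hP (i + 1)
    rw [← hf] at this
    exact (Pth_run f p p _ this).2 i (hlen (i + 1))
  · convert hS
    ext q
    constructor
    · intro h
      obtain ⟨m, hm, rfl⟩ := h 1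
      obtain ⟨m, rfl⟩ : ∃ k, m = k + 1 := ⟨m - 1, by omega⟩
      exact hin m
    · intro h n
      rw [← hext n] at h
      obtain ⟨x, hx, rfl⟩ := h
      obtain ⟨i, hi, rfl⟩ := List.getElem_of_mem hx
      have h1 : (Z n).length + i < (Z (n + 1)).length := by
        rw [hZ, List.length_append]; omega
      refine ⟨(Z n).length + i + 1, by have := hlen n; omega, ?_⟩
      show (f ((Z n).length + i)).2 = _
      have h2 : (prefixWord f (Z (n + 1)).length)[(Z n).length + i]? = some (ext n)[i] := by
        rw [hf, hZ]; simp [hi]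
      rw [prefixWord, List.getElem?_map, List.getElem?_range h1] at h2
      simp only [Option.map_some, Option.some.injEq] at h2
      rw [h2]
  · conv_rhs => rw [← hf]
    simp [prefixWord]

theorem core {ι Q' : Type} [Finite Q] [Finite Q'] {M : Auto A Q} {E F : ι → Set Q}
    {T : Transducer A Q Mem} (hg : IsGFGStrategy M (StreettAcc E F) T.strategy)
    (hu : WeaklyTightWrt M T) {C : Auto A Q'} {β : Set Q'} {h : List A → Q'}
    (hh : IsGFGStrategy C (CoBuchiAcc β) h)
    (hL : C.Lang (CoBuchiAcc β) = M.Lang (StreettAcc E F))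
    (w : ℕ → A) (r : ℕ → Q) (hs : ∀ i, r (i + 1) ∈ M.next (r i) (w i))
    (hI : ∀ i, r i ∈ InfOcc r)
    (hloop : ∀ p ∈ InfOcc r, ∃ l, Pth M p l p ∧ p ∈ sts l ∧ StreettAcc E F (sts l)) :
    LF M (StreettAcc E F) (r 0) w := by
  by_contra hw
  obtain ⟨y, hy, -⟩ := hu _ _ _ (hs 0)
  have h1 : ∀ p, ∃ l, p ∈ InfOcc r → Pth M p l p ∧ p ∈ sts l ∧ StreettAcc E F (sts l) := by
    intro p
    by_cases hp : p ∈ InfOcc r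
    · obtain ⟨l, hl⟩ := hloop p hp
      exact ⟨l, fun _ => hl⟩
    · exact ⟨[], fun h => absurd h hp⟩
  choose D hD using h1
  obtain ⟨l, hl, hlI⟩ := exists_loop w r hs hI
  obtain ⟨d, hd, hdS⟩ := insert_loops (InfOcc r) D (fun p hp => (hD p hp).1) hl hlI.le
  rw [hlI] at hdS
  have hIS : InfOcc r ⊆ sts d := by rw [hdS]; exact Set.subset_union_left
  have hDS : ∀ p ∈ InfOcc r, sts (D p) ⊆ sts d := by
    intro p hp s hsd
    rw [hdS]
    exact Or.inr ⟨p, hp, hsd⟩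
  have hacc : StreettAcc E F (sts d) := by
    intro i
    by_cases hE : sts d ∩ E i = ∅
    · exact Or.inl hE
    · right
      obtain ⟨s, hs1, hs2⟩ := Set.nonempty_iff_ne_empty.mpr hE
      obtain ⟨p, hp, hsp⟩ : ∃ p ∈ InfOcc r, s ∈ sts (D p) := by
        rw [hdS] at hs1
        rcases hs1 with hs1 | hs1
        · exact ⟨s, hs1, (hD s hs1).2.1⟩
        · exact hs1
      rcases (hD p hp).2.2 i with h3 | ⟨t, ht, ht'⟩
      · exact absurd h3 (Set.nonempty_iff_ne_empty.mp ⟨s, hsp, hs2⟩)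
      · exact ⟨t, hDS p hp ht, ht'⟩
  -- the step
  have step : ∀ Z : List (A × Q), Pth M (r 0) Z (r 0) → ∃ e, Pth M (r 0) e (r 0) ∧
      sts e = sts d ∧ ∃ v, v <+: (Z ++ e).map Prod.fst ∧ Z.length ≤ v.length ∧
        h (y ++ v) ∈ β := by
    intro Z hZ
    have hnot : app (y ++ Z.map Prod.fst) w ∉ C.Lang (CoBuchiAcc β) := by
      rw [hL, app_append]
      intro hc
      have := lang_to_LF hg _ _ hc
      rw [hy] at this
      exact hw (residual hg hu hZ w this)
    obtain ⟨b, hb, hbβ⟩ : (InfOcc (StrategyRun h (app (y ++ Z.map Prod.fst) w)) ∩ β).Nonempty := by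
      rw [Set.nonempty_iff_ne_empty]
      intro hc
      exact hnot ⟨_, (hh _).1, hc⟩
    obtain ⟨n, hn, hn'⟩ := hb (y ++ Z.map Prod.fst).length
    obtain ⟨k, rfl⟩ : ∃ k, n = (y ++ Z.map Prod.fst).length + k := Nat.exists_eq_add_of_le hn
    unfold StrategyRun at hn'
    rw [prefix_app] at hn'
    obtain ⟨K, hK, hK0⟩ := hI 0 k
    refine ⟨prefixWord (fun t => (w t, r (t + 1))) K ++ d, Pth_append ?_ hd, ?_,
      Z.map Prod.fst ++ prefixWord w k, ?_, by simp, ?_⟩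
    · have := Pth_seg (M := M) (fun t => (w t, r (t + 1))) r hs (fun _ => rfl) K
      rwa [hK0] at this
    · rw [sts_append]
      apply Set.union_eq_right.mpr
      intro q hq
      rw [mem_sts_seg] at hq
      obtain ⟨i, _, rfl⟩ := hq
      exact hIS (hI _)
    · rw [List.map_append, List.prefix_append_right_inj, List.map_append]
      refine List.IsPrefix.trans ?_ (List.prefix_append _ _)
      have e : (prefixWord (fun t => (w t, r (t + 1))) K).map Prod.fst = prefixWord w K := by
        simp [prefixWord]
      rw [e]
      obtain ⟨c, rfl⟩ := Nat.exists_eq_add_of_le hK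
      simp only [prefixWord, List.range_add, List.map_append]
      exact List.prefix_append _ _
    · rw [← List.append_assoc, hn']; exact hbβ
  choose! e he1 he2 he3 using step
  let Z : ℕ → List (A × Q) := fun n => Nat.rec [] (fun _ z => z ++ e z) n
  have hZs : ∀ j, Z (j + 1) = Z j ++ e (Z j) := fun j => rfl
  have hZP : ∀ j, Pth M (r 0) (Z j) (r 0) := by
    intro j
    induction j with
    | zero => rfl
    | succ j ih => rw [hZs]; exact Pth_append ih (he1 _ ih)
  obtain ⟨x, hx, hpre⟩ := iterate_loops (StreettAcc E F) (r 0) (sts d) hacc ⟨r 0, hIS (hI 0)⟩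
    Z (fun j => e (Z j)) rfl hZs (fun j => he2 _ (hZP j)) hZP
  rw [← hy] at hx
  have hxL := LF_to_lang hg y x hx
  rw [← hL] at hxL
  have hco := (hh _).2 hxL
  have hne := exists_infOcc_of_freq (StrategyRun h (app y x)) β (by
    intro n
    obtain ⟨v, hv, hvl, hvβ⟩ := he3 (Z n) (hZP n)
    rw [← hZs, ← (hpre (n + 1)).2] at hv
    refine ⟨y.length + v.length, by have := (hpre n).1; omega, ?_⟩
    unfold StrategyRun
    rw [prefix_app]
    have : prefixWord x v.length = v := by
      have hl := hv.length_le
      have h2 := List.prefix_iff_eq_take.mp hv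
      rw [prefixWord, List.length_map, List.length_range] at hl
      rw [prefixWord, ← List.map_take, List.take_range, min_eq_left hl] at h2
      exact h2.symm
    rw [this]
    exact hvβ)
  exact Set.nonempty_iff_ne_empty.mp hne hco

theorem LF_back {M : Auto A Q} {acc : Set Q → Prop} (w : ℕ → A) (r : ℕ → Q)
    (hs : ∀ i, r (i + 1) ∈ M.next (r i) (w i)) (N : ℕ)
    (h : LF M acc (r N) (fun t => w (N + t))) : LF M acc (r 0) w := by
  induction N with
  | zero => simpa using h
  | succ N ih =>
    apply ih
    rw [← consW_shift]
    exact LF_cons (hs N) h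

theorem shift_step {M : Auto A Q} {w : ℕ → A} {r : ℕ → Q}
    (hs : ∀ i, r (i + 1) ∈ M.next (r i) (w i)) (N : ℕ) :
    ∀ i, (fun n => r (N + n)) (i + 1) ∈ M.next ((fun n => r (N + n)) i) (w (N + i)) :=
  fun i => hs (N + i)

/-- Tight GFG Streett automata are co-Büchi-type: a tight GFG Streett
automaton whose language is GFG-co-Büchi-realizable has an equivalent GFG co-Büchi
automaton on the same structure. -/
theorem stmt7 {A Q ι : Type} [Fintype A] [Fintype Q] [Fintype ι]
    (M : Auto A Q) (E F : ι → Set Q)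
    (htight : Tight M (StreettAcc E F))
    (hreal : ∃ (Q' : Type) (_ : Fintype Q') (C : Auto A Q') (β : Set Q'),
      IsGFG C (CoBuchiAcc β) ∧ C.Lang (CoBuchiAcc β) = M.Lang (StreettAcc E F)) :
    ∃ α' : Set Q, IsGFG M (CoBuchiAcc α') ∧
      M.Lang (CoBuchiAcc α') = M.Lang (StreettAcc E F) := by
  obtain ⟨Mem, _, T, hg, hu, -⟩ := htight
  obtain ⟨Q', _, C, β, ⟨h, hh⟩, hL⟩ := hreal
  let α' : Set Q := {p | ¬ ∃ l, Pth M p l p ∧ p ∈ sts l ∧ StreettAcc E F (sts l)}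
  -- Streett accepting runs are co-Buchi accepting
  have key1 : ∀ w r, M.IsRun w r → StreettAcc E F (InfOcc r) → CoBuchiAcc α' (InfOcc r) := by
    intro w r hr hacc
    by_contra hc
    obtain ⟨p, hp, hpα⟩ := Set.nonempty_iff_ne_empty.mpr hc
    apply hpα
    obtain ⟨N, hN⟩ := eventually_infOcc r
    obtain ⟨n, hn, rfl⟩ := hp N
    obtain ⟨l, hl, hl'⟩ := exists_loop (M := M) (fun t => w (n + t)) (fun t => r (n + t))
      (shift_step hr.2 n) (by rw [infOcc_shift]; intro i; exact hN _ (by omega))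
    rw [infOcc_shift] at hl'
    exact ⟨l, hl, by rw [hl']; exact hp, by rw [hl']; exact hacc⟩
  have key2 : M.Lang (CoBuchiAcc α') = M.Lang (StreettAcc E F) := by
    apply Set.Subset.antisymm
    · rintro w ⟨r, hr, hacc⟩
      obtain ⟨N, hN⟩ := eventually_infOcc r
      have hc := core hg hu hh hL (fun t => w (N + t)) (fun t => r (N + t)) (shift_step hr.2 N)
        (by rw [infOcc_shift]; intro i; exact hN _ (by omega))
        (by
          rw [infOcc_shift]
          intro p hp
          by_contra hn
          have : p ∈ InfOcc r ∩ α' := ⟨hp, hn⟩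
          rw [hacc] at this
          exact this)
      obtain ⟨r', h0, hs, ha⟩ := LF_back w r hr.2 N hc
      exact ⟨r', ⟨by rw [h0]; exact hr.1, hs⟩, ha⟩
    · rintro w ⟨r, hr, hacc⟩
      exact ⟨r, hr, key1 w r hr hacc⟩
  refine ⟨α', ⟨T.strategy, fun w => ⟨(hg w).1, fun hw => ?_⟩⟩, key2⟩
  rw [key2] at hw
  exact key1 w _ (hg w).1 ((hg w).2 hw)

end GFG
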